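/- Let V be a finite collection of finite-valued random variables forming a Bayesian hypergraph satisfying hypergraph faithfulness, equipped with a bivariate partial information decomposition whose atoms are nonnegative, satisfy the consistency equations, and satisfy monotonicity of unique information, and suppose persistent relevance holds. Then for any distinct X_i, X_j ∈ V: Uniq^{V'}(X_j; X_i) > 0 if and only if X_j is a parent, child, or co-head of X_i in the hypergraph. -/

import Mathlib

open scoped BigOperators

/-- A probability mass function on a finite outcome space `Ω`. -/
structure FinProb (Ω : Type*) [Fintype Ω] where
  p : Ω → ℝ
  nonneg : ∀ ω, 0 ≤ p ω
  sum_one : ∑ ω, p ω = 1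

/-- The probability that the finite-valued random variable `X` takes the value `a`. -/
def prob {Ω : Type*} [Fintype Ω] {α : Type*} [DecidableEq α]
    (μ : FinProb Ω) (X : Ω → α) (a : α) : ℝ :=
  ∑ ω, if X ω = a then μ.p ω else 0

/-- Shannon mutual information `I(X ; Y)` of two finite-valued random variables
(natural logarithm; the convention `0 · log 0 = 0` holds since `Real.log 0 = 0`). -/
noncomputable def MI {Ω : Type*} [Fintype Ω] {α β : Type*}
    [Fintype α] [DecidableEq α] [Fintype β] [DecidableEq β]
    (μ : FinProb Ω) (X : Ω → α) (Y : Ω → β) : ℝ :=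
  ∑ a : α, ∑ b : β,
    prob μ (fun ω => (X ω, Y ω)) (a, b) *
      Real.log (prob μ (fun ω => (X ω, Y ω)) (a, b) /
        (prob μ X a * prob μ Y b))

/-- Conditional mutual information `I(X ; Y ∣ Z)` of finite-valued random variables. -/
noncomputable def condMI {Ω : Type*} [Fintype Ω] {α β γ : Type*}
    [Fintype α] [DecidableEq α] [Fintype β] [DecidableEq β] [Fintype γ] [DecidableEq γ]
    (μ : FinProb Ω) (X : Ω → α) (Y : Ω → β) (Z : Ω → γ) : ℝ :=
  ∑ a : α, ∑ b : β, ∑ c : γ,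
    prob μ (fun ω => (X ω, Y ω, Z ω)) (a, b, c) *
      Real.log ((prob μ Z c * prob μ (fun ω => (X ω, Y ω, Z ω)) (a, b, c)) /
        (prob μ (fun ω => (X ω, Z ω)) (a, c) * prob μ (fun ω => (Y ω, Z ω)) (b, c)))

/-- The joint random variable (supervariable) of the subfamily of `X` indexed by `s`. -/
def jointRV {Ω V α : Type*} [DecidableEq V]
    (X : V → Ω → α) (s : Finset V) : Ω → (V → Option α) :=
  fun ω i => if i ∈ s then some (X i ω) else none

/-- A bivariate partial information decomposition (PID) attached to the family `X`:
for each pair of source index sets `A, B` and target `t` it provides nonnegative atoms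
`Red A B t = Red(X_A, X_B ; X_t)`, `Uniq A B t = Uniq(X_A ; X_t ∣ X_B)` and
`Syn A B t = Syn(X_A, X_B ; X_t)` satisfying the consistency equations. -/
structure BivPID {Ω V α : Type*} [Fintype Ω] [Fintype V] [DecidableEq V]
    [Fintype α] [DecidableEq α] (μ : FinProb Ω) (X : V → Ω → α) where
  Red : Finset V → Finset V → V → ℝ
  Uniq : Finset V → Finset V → V → ℝ
  Syn : Finset V → Finset V → V → ℝ
  red_nonneg : ∀ A B t, 0 ≤ Red A B t
  uniq_nonneg : ∀ A B t, 0 ≤ Uniq A B t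
  syn_nonneg : ∀ A B t, 0 ≤ Syn A B t
  consistency_fst : ∀ A B t, MI μ (jointRV X A) (X t) = Red A B t + Uniq A B t
  consistency_snd : ∀ A B t, MI μ (jointRV X B) (X t) = Red A B t + Uniq B A t
  consistency_joint : ∀ A B t,
    MI μ (jointRV X (A ∪ B)) (X t) =
      Red A B t + Uniq A B t + Uniq B A t + Syn A B t

variable {Ω V α : Type*} [Fintype Ω] [Fintype V] [DecidableEq V] [Fintype α] [DecidableEq α]

/-- Monotonicity of unique information: augmenting the other source with further
variables cannot increase the unique information of a source. -/
def BivPID.UniqMono {μ : FinProb Ω} {X : V → Ω → α} (P : BivPID μ X) : Prop :=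
  ∀ A B K t, P.Uniq A (B ∪ K) t ≤ P.Uniq A B t

/-- Information monotonicity: augmenting a source with further variables cannot
decrease the synergy atom containing it. -/
def BivPID.SynMono {μ : FinProb Ω} {X : V → Ω → α} (P : BivPID μ X) : Prop :=
  ∀ A B K t, P.Syn A B t ≤ P.Syn (A ∪ K) B t

/-- `Uniq^{V'}(X_j ; X_i)` : unique information of `X_j` about the target `X_i`
relative to the supervariable of all the remaining variables. -/
def BivPID.uniqC {μ : FinProb Ω} {X : V → Ω → α} (P : BivPID μ X) (j i : V) : ℝ :=
  P.Uniq {j} (Finset.univ \ {i, j}) i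

/-- Persistent relevance: a variable whose conditional mutual information with the
target is positive for every conditioning set has positive unique information. -/
def BivPID.PersistentRelevance {μ : FinProb Ω} {X : V → Ω → α} (P : BivPID μ X) : Prop :=
  ∀ i t : V, i ≠ t →
    (∀ C : Finset V, C ⊆ Finset.univ \ {i, t} →
      0 < condMI μ (X i) (X t) (jointRV X C)) →
    0 < P.uniqC i t

/-- `j` is a parent of `i` in the directed hypergraph `E`. -/
def IsHParent {V : Type*} (E : Finset (Finset V × Finset V)) (j i : V) : Prop :=
  ∃ ε ∈ E, j ∈ ε.1 ∧ i ∈ ε.2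

/-- `j` is a child of `i` in the directed hypergraph `E`. -/
def IsHChild {V : Type*} (E : Finset (Finset V × Finset V)) (j i : V) : Prop :=
  ∃ ε ∈ E, j ∈ ε.2 ∧ i ∈ ε.1

/-- `j` and `i` are co-heads: some hyperedge contains both in its head. -/
def IsHCoHead {V : Type*} (E : Finset (Finset V × Finset V)) (j i : V) : Prop :=
  j ≠ i ∧ ∃ ε ∈ E, j ∈ ε.2 ∧ i ∈ ε.2

/-- `j` and `i` are co-tails: some hyperedge contains both in its tail. -/
def IsHCoTail {V : Type*} (E : Finset (Finset V × Finset V)) (j i : V) : Prop :=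
  j ≠ i ∧ ∃ ε ∈ E, j ∈ ε.1 ∧ i ∈ ε.1

/-- A step of a partially directed cycle: from a vertex to a vertex it is a parent
of, or to a distinct co-head. -/
def PDStep {V : Type*} (E : Finset (Finset V × Finset V)) (u v : V) : Prop :=
  (∃ ε ∈ E, u ∈ ε.1 ∧ v ∈ ε.2) ∨ (u ≠ v ∧ ∃ ε ∈ E, u ∈ ε.2 ∧ v ∈ ε.2)

/-- The directed hypergraph has no partially directed cycles (cyclic sequences of
parent/co-head steps containing at least one genuinely directed step). -/
def HAcyclic {V : Type*} (E : Finset (Finset V × Finset V)) : Prop :=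
  ¬ ∃ (f : ℕ → V) (k : ℕ), 0 < k ∧ f k = f 0 ∧
      (∀ i < k, PDStep E (f i) (f (i + 1))) ∧
      ∃ i < k, ∃ ε ∈ E, f i ∈ ε.1 ∧ f (i + 1) ∈ ε.2

open scoped Classical

/-- A single co-head step. -/
def CoHeadStep {V : Type*} (E : Finset (Finset V × Finset V)) (u v : V) : Prop :=
  ∃ ε ∈ E, u ∈ ε.2 ∧ v ∈ ε.2

/-- `u` and `v` lie in the same chain component: they are joined by a chain of
co-head steps. -/
def SameChain {V : Type*} (E : Finset (Finset V × Finset V)) (u v : V) : Prop :=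
  Relation.ReflTransGen (CoHeadStep E) u v

/-- The chain component of `v`. -/
noncomputable def chainComp {V : Type*} [Fintype V]
    (E : Finset (Finset V × Finset V)) (v : V) : Finset V :=
  Finset.univ.filter (fun u => SameChain E v u)

/-- The set of all chain components. -/
noncomputable def chainComps {V : Type*} [Fintype V] [DecidableEq V]
    (E : Finset (Finset V × Finset V)) : Finset (Finset V) :=
  Finset.univ.image (chainComp E)

/-- The variables in the parent chain components of `τ` (in the canonical DAG). -/
noncomputable def paVars {V : Type*} [Fintype V]
    (E : Finset (Finset V × Finset V)) (τ : Finset V) : Finset V :=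
  Finset.univ.filter (fun w => w ∉ τ ∧
    ∃ u, SameChain E u w ∧ ∃ ε ∈ E, u ∈ ε.1 ∧ ∃ h ∈ ε.2, h ∈ τ)

/-- Containment of hyperedges. -/
def EdgeContained {V : Type*} [DecidableEq V] (ε₁ ε₂ : Finset V × Finset V) : Prop :=
  ε₁.1 ∪ ε₁.2 ⊂ ε₂.1 ∪ ε₂.2

/-- An irreducible hyperedge: one not contained in any other hyperedge. -/
def IrredEdge {V : Type*} [DecidableEq V] (E : Finset (Finset V × Finset V))
    (ε : Finset V × Finset V) : Prop :=
  ε ∈ E ∧ ∀ ε' ∈ E, ¬ EdgeContained ε ε'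

/-- The irreducible hyperedges whose head meets the chain component `τ`. -/
noncomputable def edgesInto {V : Type*} [Fintype V] [DecidableEq V]
    (E : Finset (Finset V × Finset V)) (τ : Finset V) :
    Finset (Finset V × Finset V) :=
  E.filter (fun ε => (∃ h ∈ ε.2, h ∈ τ) ∧ IrredEdge E ε)

/-- The joint pmf factorizes over chain components as `∏ τ P(X_τ ∣ X_{pa(τ)})`, each
conditional being proportional to a product of nonnegative potentials over the
irreducible hyperedges of the component. -/
def HFactorizes {Ω V α : Type*} [Fintype Ω] [Fintype V] [DecidableEq V]
    [Fintype α] [DecidableEq α]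
    (μ : FinProb Ω) (X : V → Ω → α) (E : Finset (Finset V × Finset V)) : Prop :=
  ∃ (ψ : Finset V × Finset V → (V → α) → ℝ) (g : Finset V → (V → α) → ℝ),
    (∀ ε x, 0 ≤ ψ ε x) ∧
    (∀ ε ∈ E, ∀ x y : V → α, (∀ v ∈ ε.1 ∪ ε.2, x v = y v) → ψ ε x = ψ ε y) ∧
    (∀ τ x, 0 ≤ g τ x) ∧
    (∀ τ ∈ chainComps E, ∀ x y : V → α,
      (∀ v ∈ τ ∪ paVars E τ, x v = y v) → g τ x = g τ y) ∧
    (∀ τ ∈ chainComps E, ∀ x : V → α,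
      ∑ y : {v // v ∈ τ} → α,
        g τ (fun w => if h : w ∈ τ then y ⟨w, h⟩ else x w) = 1) ∧
    (∀ τ ∈ chainComps E, ∃ Z : (V → α) → ℝ,
      (∀ x y : V → α, (∀ v ∈ paVars E τ, x v = y v) → Z x = Z y) ∧
      ∀ x : V → α, Z x * g τ x = ∏ ε ∈ edgesInto E τ, ψ ε x) ∧
    (∀ x : V → α, prob μ (fun ω k => X k ω) x = ∏ τ ∈ chainComps E, g τ x)

/-- Hypergraph faithfulness: parents, children and co-heads of `i` remain
conditionally dependent on `i` given any conditioning set, while any other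
variable can be separated from `i` by some conditioning set. -/
def HFaithful {Ω V α : Type*} [Fintype Ω] [Fintype V] [DecidableEq V]
    [Fintype α] [DecidableEq α]
    (μ : FinProb Ω) (X : V → Ω → α) (E : Finset (Finset V × Finset V)) : Prop :=
  (∀ i j : V, j ≠ i →
    (IsHParent E j i ∨ IsHChild E j i ∨ IsHCoHead E j i) →
    ∀ C : Finset V, C ⊆ Finset.univ \ {i, j} →
      0 < condMI μ (X j) (X i) (jointRV X C)) ∧
  (∀ i j : V, j ≠ i →
    ¬ (IsHParent E j i ∨ IsHChild E j i ∨ IsHCoHead E j i) →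
    ∃ C : Finset V, C ⊆ Finset.univ \ {i, j} ∧
      condMI μ (X j) (X i) (jointRV X C) = 0)

/-- Hypergraph collider amplification: conditioning on a head variable strictly
increases the mutual information between any two distinct co-tails of the
same hyperedge. -/
def HColliderAmp {Ω V α : Type*} [Fintype Ω] [Fintype V] [DecidableEq V]
    [Fintype α] [DecidableEq α]
    (μ : FinProb Ω) (X : V → Ω → α) (E : Finset (Finset V × Finset V)) : Prop :=
  ∀ ε ∈ E, ∀ i ∈ ε.1, ∀ k ∈ ε.1, i ≠ k → ∀ j ∈ ε.2,
    MI μ (X i) (X k) < condMI μ (X i) (X k) (X j)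

theorem sum_prob_mul {Ω : Type*} [Fintype Ω] {α : Type*} [Fintype α] [DecidableEq α]
    (μ : FinProb Ω) (X : Ω → α) (f : α → ℝ) :
    ∑ a, prob μ X a * f a = ∑ ω, μ.p ω * f (X ω) := by
  simp only [prob, Finset.sum_mul]
  rw [Finset.sum_comm]
  simp [ite_mul]

theorem prob_pos {Ω : Type*} [Fintype Ω] {α : Type*} [DecidableEq α]
    (μ : FinProb Ω) (X : Ω → α) {ω : Ω} (hω : 0 < μ.p ω) : 0 < prob μ X (X ω) := by
  refine Finset.sum_pos' (fun ω' _ => ?_) ⟨ω, Finset.mem_univ ω, by simpa using hω⟩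
  split_ifs
  exacts [μ.nonneg ω', le_rfl]

theorem prob_congr {Ω : Type*} [Fintype Ω] {α β : Type*} [DecidableEq α] [DecidableEq β]
    (μ : FinProb Ω) {X : Ω → α} {Y : Ω → β} {a : α} {b : β}
    (h : ∀ ω, X ω = a ↔ Y ω = b) : prob μ X a = prob μ Y b :=
  Finset.sum_congr rfl fun ω _ => by simp only [h ω]

/-- Mutual information as an expectation over outcomes. -/
theorem MI_eq_sum {Ω : Type*} [Fintype Ω] {α β : Type*}
    [Fintype α] [DecidableEq α] [Fintype β] [DecidableEq β]
    (μ : FinProb Ω) (X : Ω → α) (Y : Ω → β) :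
    MI μ X Y = ∑ ω, μ.p ω * Real.log (prob μ (fun ω => (X ω, Y ω)) (X ω, Y ω) /
      (prob μ X (X ω) * prob μ Y (Y ω))) := by
  rw [← sum_prob_mul μ (fun ω => (X ω, Y ω)) (fun q => Real.log
    (prob μ (fun ω => (X ω, Y ω)) q / (prob μ X q.1 * prob μ Y q.2))), Fintype.sum_prod_type]
  rfl

/-- Conditional mutual information as an expectation over outcomes. -/
theorem condMI_eq_sum {Ω : Type*} [Fintype Ω] {α β γ : Type*}
    [Fintype α] [DecidableEq α] [Fintype β] [DecidableEq β] [Fintype γ] [DecidableEq γ]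
    (μ : FinProb Ω) (X : Ω → α) (Y : Ω → β) (Z : Ω → γ) :
    condMI μ X Y Z = ∑ ω, μ.p ω *
      Real.log ((prob μ Z (Z ω) * prob μ (fun ω => (X ω, Y ω, Z ω)) (X ω, Y ω, Z ω)) /
        (prob μ (fun ω => (X ω, Z ω)) (X ω, Z ω) *
          prob μ (fun ω => (Y ω, Z ω)) (Y ω, Z ω))) := by
  rw [← sum_prob_mul μ (fun ω => (X ω, Y ω, Z ω)) (fun q => Real.log
    ((prob μ Z q.2.2 * prob μ (fun ω => (X ω, Y ω, Z ω)) q) /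
      (prob μ (fun ω => (X ω, Z ω)) (q.1, q.2.2) *
        prob μ (fun ω => (Y ω, Z ω)) (q.2.1, q.2.2)))), Fintype.sum_prod_type]
  simp only [Fintype.sum_prod_type]
  rfl

/-- Chain rule for mutual information, where `W` carries the same information as `(X, Z)`. -/
theorem MI_eq_MI_add_condMI {Ω : Type*} [Fintype Ω] {α β γ δ : Type*}
    [Fintype α] [DecidableEq α] [Fintype β] [DecidableEq β] [Fintype γ] [DecidableEq γ]
    [Fintype δ] [DecidableEq δ]
    (μ : FinProb Ω) (X : Ω → α) (Y : Ω → β) (Z : Ω → γ) (W : Ω → δ)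
    (hW : ∀ ω ω', W ω' = W ω ↔ X ω' = X ω ∧ Z ω' = Z ω) :
    MI μ W Y = MI μ Z Y + condMI μ X Y Z := by
  rw [MI_eq_sum, MI_eq_sum, condMI_eq_sum, ← Finset.sum_add_distrib]
  refine Finset.sum_congr rfl fun ω _ => ?_
  rcases (μ.nonneg ω).eq_or_lt with h0 | hpos
  · simp [← h0]
  have hWY : prob μ (fun ω => (W ω, Y ω)) (W ω, Y ω) =
      prob μ (fun ω => (X ω, Y ω, Z ω)) (X ω, Y ω, Z ω) :=
    prob_congr μ fun ω' => by simp only [Prod.mk.injEq, hW]; tauto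
  have hWX : prob μ W (W ω) = prob μ (fun ω => (X ω, Z ω)) (X ω, Z ω) :=
    prob_congr μ fun ω' => by simp only [Prod.mk.injEq, hW]
  have hYZ : prob μ (fun ω => (Z ω, Y ω)) (Z ω, Y ω) =
      prob μ (fun ω => (Y ω, Z ω)) (Y ω, Z ω) :=
    prob_congr μ fun ω' => by simp only [Prod.mk.injEq, and_comm]
  rw [hWY, hWX, hYZ, ← mul_add]
  have hZ := prob_pos μ Z hpos
  have hY := prob_pos μ Y hpos
  have hXYZ := prob_pos μ (fun ω => (X ω, Y ω, Z ω)) hpos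
  have hXZ := prob_pos μ (fun ω => (X ω, Z ω)) hpos
  have hYZ' := prob_pos μ (fun ω => (Y ω, Z ω)) hpos
  rw [← Real.log_mul (by positivity) (by positivity)]
  congr 2
  field_simp

theorem jointRV_singleton_union_eq_iff {Ω V α : Type*} [DecidableEq V]
    (X : V → Ω → α) (j : V) (C : Finset V) (ω ω' : Ω) :
    jointRV X ({j} ∪ C) ω' = jointRV X ({j} ∪ C) ω ↔
      X j ω' = X j ω ∧ jointRV X C ω' = jointRV X C ω := by
  simp only [jointRV, funext_iff, Finset.mem_union, Finset.mem_singleton]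
  constructor
  · intro h
    refine ⟨by simpa using h j, fun v => ?_⟩
    by_cases hv : v ∈ C
    · simpa [hv] using h v
    · simp [hv]
  · rintro ⟨hj, hC⟩ v
    by_cases hv : v ∈ C
    · simpa [hv] using hC v
    · by_cases hvj : v = j
      · subst hvj
        simp [hj]
      · simp [hv, hvj]

theorem BivPID.uniq_singleton_le_condMI {Ω V α : Type*} [Fintype Ω] [Fintype V] [DecidableEq V]
    [Fintype α] [DecidableEq α] {μ : FinProb Ω} {X : V → Ω → α} (P : BivPID μ X)
    (j t : V) (C : Finset V) :
    P.Uniq {j} C t ≤ condMI μ (X j) (X t) (jointRV X C) := by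
  have hchain := MI_eq_MI_add_condMI μ (X j) (X t) (jointRV X C) (jointRV X ({j} ∪ C))
    (jointRV_singleton_union_eq_iff X j C)
  linarith [P.consistency_snd {j} C t, P.consistency_joint {j} C t, P.syn_nonneg {j} C t]

/-- In a faithful Bayesian hypergraph, a variable `X_j` has
positive unique information about the target `X_i` (relative to the supervariable
complement) iff `X_j` is a parent, child, or co-head of `X_i`. -/
theorem hypergraph_unique_information
    {Ω V α : Type*} [Fintype Ω] [Fintype V] [DecidableEq V] [Fintype α] [DecidableEq α]
    (μ : FinProb Ω) (X : V → Ω → α) (E : Finset (Finset V × Finset V))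
    (hdisj : ∀ ε ∈ E, Disjoint ε.1 ε.2)
    (hacyc : HAcyclic E)
    (hfact : HFactorizes μ X E)
    (hfaith : HFaithful μ X E)
    (P : BivPID μ X) (hmono : P.UniqMono) (hpr : P.PersistentRelevance)
    (i j : V) (hij : j ≠ i) :
    0 < P.uniqC j i ↔
      (IsHParent E j i ∨ IsHChild E j i ∨ IsHCoHead E j i) := by
  refine ⟨fun hpos => ?_, fun h => ?_⟩
  · by_contra hne
    obtain ⟨C, hC, hzero⟩ := hfaith.2 i j hij hne
    have hmonoC := hmono {j} C (Finset.univ \ {i, j}) i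
    rw [Finset.union_eq_right.2 hC] at hmonoC
    have hle := P.uniq_singleton_le_condMI j i C
    rw [BivPID.uniqC] at hpos
    linarith
  · refine hpr j i hij fun C hC => hfaith.1 i j hij h C ?_
    rwa [Finset.pair_comm]
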